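/- Let (p,u,U) be a smooth solution of the incompressible Navier-Stokes equations on [0,T_0]×T^3 with T_0 < ∞ and let (p^{ε,δ},u^{ε,δ},U^{ε,δ}) solve the two-parameter relaxation system with smooth initial data. Set ω = curl u, ω^{ε,δ} = curl u^{ε,δ}, A = curl ∇·(u⊗u), A^{ε,δ} = curl ∇·(u^{ε,δ}⊗u^{ε,δ}), K = 1 + ‖(p,u,U)‖²_{C⁰H³}, and T_II(t) = −∫_{T³} (ω^{ε,δ} − ω) · (A^{ε,δ} − A) dx. Suppose there are constants M, μ > 0 independent of δ such that at time t: ‖u^{ε,δ}(t,·)‖²_{L^∞(T³)} + ‖∇u^{ε,δ}(t,·)‖²_{L³(T³)} ≤ M; δ^{−1/2}‖div u^{ε,δ}(t,·)‖²_{L²(T³)} + δ^{1/2}‖∇ div u^{ε,δ}(t,·)‖²_{L²(T³)} ≤ μ; and ‖(u^{ε,δ} − u)(t,·)‖²_{L²(T³)} ≤ μ δ^{1/2}. Then for all sufficiently small δ, |T_II(t)| ≤ (7/10)‖∇(ω^{ε,δ} − ω)(t,·)‖²_{L²(T³)} + C(K+M)μδ^{1/2}, where C depends only on the domain T³. -/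

import Mathlib

/-!
Common setup: fields on the torus `𝕋^d = ℝ^d/ℤ^d` are modelled as `ℤ^d`-periodic
functions on `ℝ^d`; all integrals are taken over the fundamental cell `[0,1]^d`.
-/

noncomputable section
open MeasureTheory Real
open scoped ENNReal

namespace NSRelax

/-- Spatial variable; fields on the torus are `ℤ^d`-periodic functions on `ℝ^d`. -/
abbrev Spc (d : ℕ) := Fin d → ℝ

/-- Vectors in `ℝ^m`. -/
abbrev Vec (m : ℕ) := Fin m → ℝ

/-- Fundamental cell `[0,1]^d` of the torus. -/
def cube (d : ℕ) : Set (Spc d) := Set.pi Set.univ fun _ => Set.Icc (0 : ℝ) 1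

/-- `ℤ^d`-periodicity. -/
def Per {d : ℕ} {E : Type*} (f : Spc d → E) : Prop :=
  ∀ (x : Spc d) (k : Fin d → ℤ), f (fun i => x i + (k i : ℝ)) = f x

/-- `i`-th spatial partial derivative of a scalar field. -/
def pd {d : ℕ} (i : Fin d) (f : Spc d → ℝ) (x : Spc d) : ℝ :=
  fderiv ℝ f x (Pi.single i 1)

/-- Time derivative of a time-dependent scalar field. -/
def dtS {d : ℕ} (p : ℝ → Spc d → ℝ) (t : ℝ) (x : Spc d) : ℝ :=
  deriv (fun s => p s x) t

/-- Time derivative of a time-dependent vector field. -/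
def dtV {d m : ℕ} (u : ℝ → Spc d → Vec m) (t : ℝ) (x : Spc d) : Vec m :=
  fun a => deriv (fun s => u s x a) t

/-- Time derivative of a time-dependent matrix field. -/
def dtM {d m : ℕ} (U : ℝ → Spc d → Fin m → Fin m → ℝ) (t : ℝ) (x : Spc d) :
    Fin m → Fin m → ℝ :=
  fun i j => deriv (fun s => U s x i j) t

section Norms

variable {d : ℕ} {ι : Type*} [Fintype ι]

/-- Pointwise squared Euclidean magnitude of an `ι`-indexed field. -/
def ptsq (v : Spc d → ι → ℝ) (x : Spc d) : ℝ := ∑ a, v x a ^ 2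

/-- Pointwise squared magnitude of the first derivatives. -/
def ptsqD1 (v : Spc d → ι → ℝ) (x : Spc d) : ℝ :=
  ∑ a, ∑ i, pd i (fun y => v y a) x ^ 2

/-- Pointwise squared magnitude of the second derivatives. -/
def ptsqD2 (v : Spc d → ι → ℝ) (x : Spc d) : ℝ :=
  ∑ a, ∑ i, ∑ j, pd i (pd j (fun y => v y a)) x ^ 2

/-- Pointwise squared magnitude of the third derivatives. -/
def ptsqD3 (v : Spc d → ι → ℝ) (x : Spc d) : ℝ :=
  ∑ a, ∑ i, ∑ j, ∑ k, pd i (pd j (pd k (fun y => v y a))) x ^ 2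

/-- Squared `L²(𝕋^d)` norm. -/
def L2sq (v : Spc d → ι → ℝ) : ℝ := ∫ x in cube d, ptsq v x

/-- Squared `L²(𝕋^d)` norm of the gradient. -/
def D1L2sq (v : Spc d → ι → ℝ) : ℝ := ∫ x in cube d, ptsqD1 v x

/-- Squared `L²(𝕋^d)` norm of the second derivatives. -/
def D2L2sq (v : Spc d → ι → ℝ) : ℝ := ∫ x in cube d, ptsqD2 v x

/-- Squared `L²(𝕋^d)` norm of the third derivatives. -/
def D3L2sq (v : Spc d → ι → ℝ) : ℝ := ∫ x in cube d, ptsqD3 v x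

/-- Squared `H¹(𝕋^d)` norm. -/
def H1sq (v : Spc d → ι → ℝ) : ℝ := L2sq v + D1L2sq v

/-- Squared `H²(𝕋^d)` norm. -/
def H2sq (v : Spc d → ι → ℝ) : ℝ := L2sq v + D1L2sq v + D2L2sq v

/-- Squared `H³(𝕋^d)` norm. -/
def H3sq (v : Spc d → ι → ℝ) : ℝ := L2sq v + D1L2sq v + D2L2sq v + D3L2sq v

/-- `L^p(𝕋^d)` norm. -/
def LpN (p : ℝ) (v : Spc d → ι → ℝ) : ℝ :=
  (∫ x in cube d, Real.sqrt (ptsq v x) ^ p) ^ (1 / p)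

/-- `L^∞(𝕋^d)` norm (for continuous periodic fields). -/
def LinfN (v : Spc d → ι → ℝ) : ℝ := ⨆ x : Spc d, Real.sqrt (ptsq v x)

end Norms

/-- View a scalar field as a one-component indexed field. -/
def sc {d : ℕ} (f : Spc d → ℝ) : Spc d → Vec 1 := fun x _ => f x

/-- View a matrix field as an indexed field. -/
def mtx {d m : ℕ} (U : Spc d → Fin m → Fin m → ℝ) : Spc d → Fin m × Fin m → ℝ :=
  fun x ij => U x ij.1 ij.2

/-- Divergence of a vector field. -/
def divv {d : ℕ} (v : Spc d → Vec d) (x : Spc d) : ℝ := ∑ i, pd i (fun y => v y i) x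

/-- Row-wise divergence of a matrix field. -/
def divM {d : ℕ} (U : Spc d → Fin d → Fin d → ℝ) (x : Spc d) : Vec d :=
  fun i => ∑ j, pd j (fun y => U y i j) x

/-- Laplacian of a scalar field. -/
def lapS {d : ℕ} (f : Spc d → ℝ) (x : Spc d) : ℝ := ∑ i, pd i (pd i f) x

/-- Componentwise Laplacian of a vector field. -/
def lapV {d m : ℕ} (v : Spc d → Vec m) (x : Spc d) : Vec m :=
  fun a => lapS (fun y => v y a) x

/-- Tensor product `u ⊗ v` of vector fields. -/
def tens {d : ℕ} (u v : Spc d → Vec d) (x : Spc d) : Fin d → Fin d → ℝ :=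
  fun i j => u x i * v x j

/-- Curl of a three-dimensional vector field. -/
def curl3 (v : Spc 3 → Vec 3) (x : Spc 3) : Vec 3 :=
  ![pd 1 (fun y => v y 2) x - pd 2 (fun y => v y 1) x,
    pd 2 (fun y => v y 0) x - pd 0 (fun y => v y 2) x,
    pd 0 (fun y => v y 1) x - pd 1 (fun y => v y 0) x]

/-- Scalar curl of a planar vector field. -/
def curl2 (v : Spc 2 → Vec 2) (x : Spc 2) : ℝ :=
  pd 0 (fun y => v y 1) x - pd 1 (fun y => v y 0) x

/-- Smoothness (jointly in time and space) of a scalar field. -/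
def SmoothS {d : ℕ} (p : ℝ → Spc d → ℝ) : Prop :=
  ContDiff ℝ (⊤ : ℕ∞) fun q : ℝ × Spc d => p q.1 q.2

/-- Smoothness (jointly in time and space) of a vector field. -/
def SmoothV {d m : ℕ} (u : ℝ → Spc d → Vec m) : Prop :=
  ContDiff ℝ (⊤ : ℕ∞) fun q : ℝ × Spc d => u q.1 q.2

/-- Smoothness (jointly in time and space) of a matrix field. -/
def SmoothM {d m : ℕ} (U : ℝ → Spc d → Fin m → Fin m → ℝ) : Prop :=
  ContDiff ℝ (⊤ : ℕ∞) fun q : ℝ × Spc d => U q.1 q.2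

/-- Stress tensor `U = u ⊗ u − ∇u` of a Navier–Stokes solution. -/
def stress {d : ℕ} (u : ℝ → Spc d → Vec d) (t : ℝ) (x : Spc d) : Fin d → Fin d → ℝ :=
  fun i j => u t x i * u t x j - pd j (fun y => u t y i) x

/-- Smooth solution of the incompressible Navier–Stokes equations on the time set `I`. -/
structure IsNS (d : ℕ) (I : Set ℝ) (p : ℝ → Spc d → ℝ) (u : ℝ → Spc d → Vec d) :
    Prop where
  smooth_p : SmoothS p
  smooth_u : SmoothV u
  per_p : ∀ t, Per (p t)
  per_u : ∀ t, Per (u t)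
  div_free : ∀ t ∈ I, ∀ x, divv (u t) x = 0
  momentum : ∀ t ∈ I, ∀ x a,
    dtV u t x a + divM (tens (u t) (u t)) x a = -pd a (p t) x + lapV (u t) x a
  mean_zero : ∀ t ∈ I, ∫ x in cube d, p t x = 0

/-- The time interval `[0, Tl)`. -/
def Itv (Tl : ℝ≥0∞) : Set ℝ := {t : ℝ | 0 ≤ t ∧ ENNReal.ofReal t < Tl}

/-- Solution of the two-parameter relaxation system on the time interval `[0, Tl)`,
with smooth initial data. -/
structure IsRelax (d : ℕ) (ε δ : ℝ) (Tl : ℝ≥0∞) (p : ℝ → Spc d → ℝ)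
    (u : ℝ → Spc d → Vec d) (U : ℝ → Spc d → Fin d → Fin d → ℝ) : Prop where
  pos : 0 < Tl
  init_smooth : ContDiff ℝ (⊤ : ℕ∞) fun x : Spc d => (p 0 x, u 0 x, U 0 x)
  per_p : ∀ t ∈ Itv Tl, Per (p t)
  per_u : ∀ t ∈ Itv Tl, Per (u t)
  per_U : ∀ t ∈ Itv Tl, Per (U t)
  cont : ContinuousOn (fun q : ℝ × Spc d => (p q.1 q.2, u q.1 q.2, U q.1 q.2))
    (Itv Tl ×ˢ (Set.univ : Set (Spc d)))
  smooth : ∀ t ∈ Itv Tl, 0 < t → ∀ x : Spc d,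
    ContDiffAt ℝ (⊤ : ℕ∞) (fun q : ℝ × Spc d => (p q.1 q.2, u q.1 q.2, U q.1 q.2)) (t, x)
  mass : ∀ t ∈ Itv Tl, 0 < t → ∀ x, ε * dtS p t x + divv (u t) x = 0
  momentum : ∀ t ∈ Itv Tl, 0 < t → ∀ x a,
    dtV u t x a + divM (U t) x a + pd a (p t) x = 0
  stress_eq : ∀ t ∈ Itv Tl, 0 < t → ∀ x i j,
    δ * dtM U t x i j + pd j (fun y => u t y i) x = u t x i * u t x j - U t x i j

/-- Relaxation solution whose lifespan `Tl` is maximal (among solutions with the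
same initial data). -/
def IsMaxRelax (d : ℕ) (ε δ : ℝ) (Tl : ℝ≥0∞) (p : ℝ → Spc d → ℝ)
    (u : ℝ → Spc d → Vec d) (U : ℝ → Spc d → Fin d → Fin d → ℝ) : Prop :=
  IsRelax d ε δ Tl p u U ∧
    ∀ (Tl' : ℝ≥0∞) (p' : ℝ → Spc d → ℝ) (u' : ℝ → Spc d → Vec d)
      (U' : ℝ → Spc d → Fin d → Fin d → ℝ),
      IsRelax d ε δ Tl' p' u' U' → p' 0 = p 0 → u' 0 = u 0 → U' 0 = U 0 → Tl' ≤ Tl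

/-- Smooth solution of the intermediate affine system on `[0,T]`. -/
structure IsAffine (ε δ T : ℝ) (u : ℝ → Spc 3 → Vec 3) (p' : ℝ → Spc 3 → ℝ)
    (u' : ℝ → Spc 3 → Vec 3) (U' : ℝ → Spc 3 → Fin 3 → Fin 3 → ℝ) : Prop where
  smooth_p : SmoothS p'
  smooth_u : SmoothV u'
  smooth_U : SmoothM U'
  per_p : ∀ t, Per (p' t)
  per_u : ∀ t, Per (u' t)
  per_U : ∀ t, Per (U' t)
  mass : ∀ t ∈ Set.Icc (0 : ℝ) T, ∀ x, ε * dtS p' t x + divv (u' t) x = 0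
  momentum : ∀ t ∈ Set.Icc (0 : ℝ) T, ∀ x a,
    dtV u' t x a + divM (U' t) x a + pd a (p' t) x = 0
  stress_eq : ∀ t ∈ Set.Icc (0 : ℝ) T, ∀ x i j,
    δ * dtM U' t x i j + pd j (fun y => u' t y i) x = u t x i * u t x j - U' t x i j

/-- `A = curl ∇·(v ⊗ v)`. -/
def Af (v : Spc 3 → Vec 3) (x : Spc 3) : Vec 3 :=
  curl3 (fun y => divM (tens v v) y) x

/-- `K = 1 + ‖(p,u,U)‖²_{C⁰H³}`. -/
def Kc (T0 : ℝ) (p : ℝ → Spc 3 → ℝ) (u : ℝ → Spc 3 → Vec 3) : ℝ :=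
  1 + ⨆ t ∈ Set.Icc (0 : ℝ) T0, (H3sq (sc (p t)) + H3sq (u t) + H3sq (mtx (stress u t)))

/-- `K = 1 + ‖u‖²_{C⁰H³}`. -/
def Ku (T0 : ℝ) (u : ℝ → Spc 3 → Vec 3) : ℝ :=
  1 + ⨆ t ∈ Set.Icc (0 : ℝ) T0, H3sq (u t)

lemma isCompact_cube : IsCompact (cube 3) := isCompact_univ_pi fun _ => isCompact_Icc

lemma integrableOn_cube {f : Spc 3 → ℝ} (hf : Continuous f) : IntegrableOn f (cube 3) :=
  hf.continuousOn.integrableOn_compact isCompact_cube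

lemma ofReal_integral_cube {f : Spc 3 → ℝ} (hf : Continuous f) (h0 : ∀ x, 0 ≤ f x) :
    ENNReal.ofReal (∫ x in cube 3, f x) = ∫⁻ x in cube 3, ENNReal.ofReal (f x) :=
  ofReal_integral_eq_lintegral_ofReal (integrableOn_cube hf) (Filter.Eventually.of_forall h0)

lemma integral_cube_add {f g : Spc 3 → ℝ} (hf : Continuous f) (hg : Continuous g) :
    ∫ x in cube 3, (f x + g x) = (∫ x in cube 3, f x) + ∫ x in cube 3, g x :=
  integral_add (integrableOn_cube hf) (integrableOn_cube hg)

lemma integral_cube_sub {f g : Spc 3 → ℝ} (hf : Continuous f) (hg : Continuous g) :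
    ∫ x in cube 3, (f x - g x) = (∫ x in cube 3, f x) - ∫ x in cube 3, g x :=
  integral_sub (integrableOn_cube hf) (integrableOn_cube hg)

lemma integral_cube_mono {f g : Spc 3 → ℝ} (hf : Continuous f) (hg : Continuous g)
    (h : ∀ x, f x ≤ g x) : ∫ x in cube 3, f x ≤ ∫ x in cube 3, g x :=
  integral_mono (integrableOn_cube hf) (integrableOn_cube hg) h

/-- Smooth `ℤ^3`-periodic scalar fields. -/
structure SmoothPer (f : Spc 3 → ℝ) : Prop where
  smooth : ContDiff ℝ (⊤ : ℕ∞) f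
  per : Per f

namespace SmoothPer

variable {f g : Spc 3 → ℝ}

lemma const (c : ℝ) : SmoothPer fun _ => c := ⟨contDiff_const, fun _ _ => rfl⟩

lemma add (hf : SmoothPer f) (hg : SmoothPer g) : SmoothPer fun x => f x + g x :=
  ⟨hf.smooth.add hg.smooth, fun x k => by simp only [hf.per x k, hg.per x k]⟩

lemma sub (hf : SmoothPer f) (hg : SmoothPer g) : SmoothPer fun x => f x - g x :=
  ⟨hf.smooth.sub hg.smooth, fun x k => by simp only [hf.per x k, hg.per x k]⟩

lemma mul (hf : SmoothPer f) (hg : SmoothPer g) : SmoothPer fun x => f x * g x :=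
  ⟨hf.smooth.mul hg.smooth, fun x k => by simp only [hf.per x k, hg.per x k]⟩

lemma pow (hf : SmoothPer f) (n : ℕ) : SmoothPer fun x => f x ^ n :=
  ⟨hf.smooth.pow n, fun x k => by simp only [hf.per x k]⟩

lemma sum {ι : Type*} (s : Finset ι) {F : ι → Spc 3 → ℝ} (h : ∀ a ∈ s, SmoothPer (F a)) :
    SmoothPer fun x => ∑ a ∈ s, F a x :=
  ⟨ContDiff.sum fun a ha => (h a ha).smooth,
    fun x k => Finset.sum_congr rfl fun a ha => (h a ha).per x k⟩

lemma differentiable (hf : SmoothPer f) : Differentiable ℝ f :=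
  hf.smooth.differentiable (by simp)

lemma continuous (hf : SmoothPer f) : Continuous f := hf.smooth.continuous

lemma pd (hf : SmoothPer f) (i : Fin 3) : SmoothPer (pd i f) where
  smooth := by
    have h : ContDiff ℝ (⊤ : ℕ∞) (fderiv ℝ f) := hf.smooth.fderiv_right (by simp)
    exact h.clm_apply contDiff_const
  per := fun x k => by
    have h : (fun y : Spc 3 => f (y + fun i => (k i : ℝ))) = f := funext fun y => hf.per y k
    have h2 := fderiv_comp_add_right (𝕜 := ℝ) (f := f) (x := x) (fun i => (k i : ℝ))
    rw [h] at h2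
    unfold NSRelax.pd
    rw [h2]
    rfl

lemma integrableOn (hf : SmoothPer f) : IntegrableOn f (cube 3) :=
  integrableOn_cube hf.continuous

end SmoothPer

section Calculus

variable {f g : Spc 3 → ℝ}

lemma pd_add (hf : SmoothPer f) (hg : SmoothPer g) (i : Fin 3) (x : Spc 3) :
    pd i (fun y => f y + g y) x = pd i f x + pd i g x := by
  unfold pd
  rw [fderiv_fun_add (hf.differentiable x) (hg.differentiable x)]
  rfl

lemma pd_sub (hf : SmoothPer f) (hg : SmoothPer g) (i : Fin 3) (x : Spc 3) :
    pd i (fun y => f y - g y) x = pd i f x - pd i g x := by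
  unfold pd
  rw [fderiv_fun_sub (hf.differentiable x) (hg.differentiable x)]
  rfl

lemma pd_mul (hf : SmoothPer f) (hg : SmoothPer g) (i : Fin 3) (x : Spc 3) :
    pd i (fun y => f y * g y) x = f x * pd i g x + g x * pd i f x := by
  unfold pd
  rw [fderiv_fun_mul (hf.differentiable x) (hg.differentiable x)]
  simp

lemma pd_comm (hf : SmoothPer f) (i j : Fin 3) (x : Spc 3) :
    pd i (pd j f) x = pd j (pd i f) x := by
  have h : ∀ i j : Fin 3, pd i (pd j f) x
      = fderiv ℝ (fderiv ℝ f) x (Pi.single i 1) (Pi.single j 1) := by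
    intro i j
    have hd : DifferentiableAt ℝ (fderiv ℝ f) x :=
      (hf.smooth.fderiv_right (m := (⊤ : ℕ∞)) (by simp)).differentiable
        (by simp) x
    change fderiv ℝ (fun y => fderiv ℝ f y (Pi.single j 1)) x (Pi.single i 1) = _
    rw [fderiv_clm_apply hd (differentiableAt_const _)]
    simp
  rw [h i j, h j i]
  exact (hf.smooth.contDiffAt.isSymmSndFDerivAt
    (by simpa using (WithTop.coe_le_coe.2 le_top : ((2 : ℕ∞) : WithTop ℕ∞) ≤ (⊤ : ℕ∞)))).eq _ _

lemma hasDerivAt_update_pd (hf : SmoothPer f) (x : Spc 3) (i : Fin 3) (s : ℝ) :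
    HasDerivAt (fun r => f (Function.update x i r)) (pd i f (Function.update x i s)) s :=
  (hf.differentiable (Function.update x i s)).hasFDerivAt.comp_hasDerivAt s
    (hasDerivAt_update x i s)

lemma cube_eq_Icc : cube 3 = Set.Icc (0 : Spc 3) 1 := by
  unfold cube
  rw [Set.pi_univ_Icc]
  rfl

lemma volume_restrict_cube :
    (volume : Measure (Spc 3)).restrict (cube 3)
      = Measure.pi fun _ => (volume : Measure ℝ).restrict (Set.Icc 0 1) := by
  unfold cube
  rw [volume_pi, Measure.restrict_pi_pi]

lemma integral_pd_eq_zero (hf : SmoothPer f) (i : Fin 3) : ∫ x in cube 3, pd i f x = 0 := by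
  rw [cube_eq_Icc]
  have key := integral_divergence_of_hasFDerivAt_off_countable' (E := ℝ) (n := 2)
    (0 : Spc 3) 1 (by intro j; simp) (fun j => if j = i then f else 0)
    (fun j => if j = i then fderiv ℝ f else 0) ∅ Set.countable_empty
    (by
      intro j
      split_ifs
      · exact hf.continuous.continuousOn
      · exact continuousOn_const)
    (by
      intro x _ j
      split_ifs
      · exact (hf.differentiable x).hasFDerivAt
      · exact hasFDerivAt_const _ _)
    (by
      have h : (fun x : Spc 3 => ∑ j, (if j = i then fderiv ℝ f else 0) x (Pi.single j 1))
          = pd i f := by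
        funext x
        rw [Finset.sum_eq_single i]
        · simp [pd]
        · intro j _ hj
          simp [hj]
        · simp
      rw [h, ← cube_eq_Icc]
      exact (hf.pd i).integrableOn)
  have h : (fun x : Spc 3 => ∑ j, (if j = i then fderiv ℝ f else 0) x (Pi.single j 1))
      = pd i f := by
    funext x
    rw [Finset.sum_eq_single i]
    · simp [pd]
    · intro j _ hj
      simp [hj]
    · simp
  rw [h] at key
  rw [key]
  refine Finset.sum_eq_zero fun j _ => ?_
  by_cases hj : j = i
  · subst hj
    simp only [if_true]
    rw [sub_eq_zero]
    congr 1
    funext y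
    have := hf.per (j.insertNth ((0 : Spc 3) j) y) (Pi.single j 1)
    rw [← this]
    congr 1
    funext k
    refine Fin.succAboveCases j ?_ (fun l => ?_) k
    · simp
    · simp
  · simp [hj]

end Calculus

section Sobolev

variable {f : Spc 3 → ℝ}

lemma abs_le_integral_add_deriv {g g' : ℝ → ℝ} (hg : ∀ s, HasDerivAt g (g' s) s)
    (hc : Continuous g') {s : ℝ} (hs : s ∈ Set.Icc (0 : ℝ) 1) :
    |g s| ≤ ∫ r in (0 : ℝ)..1, (|g r| + |g' r|) := by
  have hgc : Continuous g := continuous_iff_continuousAt.2 fun r => (hg r).continuousAt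
  have hi : IntervalIntegrable (fun r => |g' r|) volume 0 1 := hc.abs.intervalIntegrable _ _
  have hpt : ∀ r ∈ Set.Icc (0 : ℝ) 1, |g s| ≤ |g r| + ∫ q in (0 : ℝ)..1, |g' q| := by
    intro r hr
    have h1 : ∫ q in r..s, g' q = g s - g r :=
      intervalIntegral.integral_eq_sub_of_hasDerivAt (fun q _ => hg q)
        (hc.intervalIntegrable _ _)
    have h2 : |∫ q in r..s, g' q| ≤ ∫ q in (0 : ℝ)..1, |g' q| := by
      calc |∫ q in r..s, g' q| ≤ ∫ q in Set.uIoc r s, |g' q| := by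
            simpa using intervalIntegral.norm_integral_le_integral_norm_uIoc
              (f := g') (a := r) (b := s) (μ := volume)
        _ ≤ ∫ q in Set.Ioc (0 : ℝ) 1, |g' q| := by
            refine setIntegral_mono_set ?_ ?_ ?_
            · exact (intervalIntegrable_iff_integrableOn_Ioc_of_le zero_le_one).1 hi
            · exact Filter.Eventually.of_forall fun q => abs_nonneg _
            · refine LE.le.eventuallyLE fun q hq => ?_
              rw [Set.mem_uIoc] at hq
              rcases hq with hq | hq
              · exact ⟨hr.1.trans_lt hq.1, hq.2.trans hs.2⟩
              · exact ⟨hs.1.trans_lt hq.1, hq.2.trans hr.2⟩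
        _ = ∫ q in (0 : ℝ)..1, |g' q| := (intervalIntegral.integral_of_le zero_le_one).symm
    rw [h1] at h2
    have h3 := abs_sub_abs_le_abs_sub (g s) (g r)
    linarith
  rw [intervalIntegral.integral_add (hgc.abs.intervalIntegrable _ _) hi]
  have h := intervalIntegral.integral_mono_on (μ := volume) (zero_le_one (α := ℝ))
    (f := fun _ => |g s|) (g := fun r => |g r| + ∫ q in (0 : ℝ)..1, |g' q|)
    (continuous_const.intervalIntegrable _ _)
    ((hgc.abs.add continuous_const).intervalIntegrable _ _) hpt
  rw [intervalIntegral.integral_add (hgc.abs.intervalIntegrable _ _)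
    (continuous_const.intervalIntegrable _ _)] at h
  simpa using h

lemma enorm_le_lintegral_update (hf : SmoothPer f) (i : Fin 3) (x : Spc 3) :
    ENNReal.ofReal |f x| ≤ ∫⁻ s in Set.Icc (0 : ℝ) 1,
      (ENNReal.ofReal |f (Function.update x i s)|
        + ENNReal.ofReal |pd i f (Function.update x i s)|) := by
  have hu : Continuous fun s : ℝ => Function.update x i s :=
    continuous_const.update i continuous_id
  have h1 := abs_le_integral_add_deriv (g := fun r => f (Function.update x i r))
    (hasDerivAt_update_pd hf x i) ((hf.pd i).continuous.comp hu) (s := Int.fract (x i))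
    ⟨Int.fract_nonneg _, (Int.fract_lt_one _).le⟩
  have h2 : f (Function.update x i (Int.fract (x i))) = f x := by
    rw [← hf.per (Function.update x i (Int.fract (x i))) (Pi.single i ⌊x i⌋)]
    congr 1
    funext k
    by_cases hk : k = i
    · subst hk
      simp
    · simp [hk]
  simp only [h2] at h1
  have hc : Continuous fun r : ℝ =>
      |f (Function.update x i r)| + |pd i f (Function.update x i r)| :=
    (hf.continuous.comp hu).abs.add ((hf.pd i).continuous.comp hu).abs
  calc ENNReal.ofReal |f x| ≤ ENNReal.ofReal (∫ r in Set.Icc (0 : ℝ) 1,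
        (|f (Function.update x i r)| + |pd i f (Function.update x i r)|)) := by
        refine ENNReal.ofReal_le_ofReal (h1.trans_eq ?_)
        rw [intervalIntegral.integral_of_le zero_le_one, integral_Icc_eq_integral_Ioc]
    _ = ∫⁻ s in Set.Icc (0 : ℝ) 1, ENNReal.ofReal
        (|f (Function.update x i s)| + |pd i f (Function.update x i s)|) := by
        refine ofReal_integral_eq_lintegral_ofReal
          (hc.continuousOn.integrableOn_compact isCompact_Icc) ?_
        exact Filter.Eventually.of_forall fun r => by positivity
    _ = _ := by
        refine lintegral_congr fun s => ?_
        rw [ENNReal.ofReal_add (abs_nonneg _) (abs_nonneg _)]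

/-- Sum of `|f|` and of the absolute values of its mixed derivatives of order at most one in
each variable. -/
def mixedSum (f : Spc 3 → ℝ) (x : Spc 3) : ℝ :=
  ((|f x| + |pd 2 f x|) + (|pd 1 f x| + |pd 2 (pd 1 f) x|))
    + ((|pd 0 f x| + |pd 2 (pd 0 f) x|) + (|pd 1 (pd 0 f) x| + |pd 2 (pd 1 (pd 0 f)) x|))

lemma abs_le_integral_mixedSum (hf : SmoothPer f) (x : Spc 3) :
    |f x| ≤ ∫ y in cube 3, mixedSum f y := by
  set ν : Fin 3 → Measure ℝ := fun _ => (volume : Measure ℝ).restrict (Set.Icc 0 1) with hν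
  set e : (Spc 3 → ℝ) → Spc 3 → ℝ≥0∞ := fun g y => ENNReal.ofReal |g y| with he
  have hm : ∀ {g}, SmoothPer g → Measurable (e g) := fun hg =>
    (ENNReal.continuous_ofReal.comp hg.continuous.abs).measurable
  have step : ∀ (i : Fin 3) (s : Finset (Fin 3)) (F : (Spc 3 → ℝ) → Spc 3 → ℝ≥0∞), i ∉ s →
      (∀ g, SmoothPer g → Measurable (F g)) →
      (∀ g, SmoothPer g → e g ≤ lmarginal ν s (F g)) → ∀ g, SmoothPer g →
      e g ≤ lmarginal ν (insert i s) (fun y => F g y + F (pd i g) y) := by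
    intro i s F hi hF hle g hg y
    have h1 : e g y ≤ lmarginal ν {i} (fun y => e g y + e (pd i g) y) y := by
      rw [lmarginal_singleton]
      exact enorm_le_lintegral_update hg i y
    refine h1.trans ?_
    rw [Finset.insert_eq, lmarginal_union ν _
      (show Measurable fun y => F g y + F (pd i g) y from (hF g hg).add (hF _ (hg.pd i)))
      (Finset.disjoint_singleton_left.mpr hi)]
    refine lmarginal_mono (fun z => ?_) y
    calc e g z + e (pd i g) z ≤ lmarginal ν s (F g) z + lmarginal ν s (F (pd i g)) z :=
          add_le_add (hle g hg z) (hle _ (hg.pd i) z)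
      _ = _ := by
          unfold lmarginal
          exact (lintegral_add_left ((hF g hg).comp measurable_updateFinset) _).symm
  have m2 : ∀ g, SmoothPer g → Measurable fun y => e g y + e (pd 2 g) y := fun g hg =>
    (hm hg).add (hm (hg.pd 2))
  have m1 : ∀ g, SmoothPer g → Measurable fun y =>
      (e g y + e (pd 2 g) y) + (e (pd 1 g) y + e (pd 2 (pd 1 g)) y) := fun g hg =>
    (m2 g hg).add (m2 _ (hg.pd 1))
  have s2 := step 2 ∅ e (by simp) (fun g hg => hm hg) (fun g hg => by simp)
  have s1 := step 1 _ _ (by decide) m2 s2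
  have s0 := step 0 _ _ (by decide) m1 s1 f hf x
  have hu : (insert 0 (insert 1 (insert 2 ∅)) : Finset (Fin 3)) = Finset.univ := by decide
  rw [hu, lmarginal_univ, hν, ← volume_restrict_cube] at s0
  have hc : Continuous (mixedSum f) := by
    have := hf.continuous
    have := (hf.pd 0).continuous
    have := (hf.pd 1).continuous
    have := (hf.pd 2).continuous
    have := ((hf.pd 1).pd 2).continuous
    have := ((hf.pd 0).pd 2).continuous
    have := ((hf.pd 0).pd 1).continuous
    have := (((hf.pd 0).pd 1).pd 2).continuous
    unfold mixedSum
    fun_prop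
  have hn : ∀ y, 0 ≤ mixedSum f y := fun y => by unfold mixedSum; positivity
  rw [← ENNReal.ofReal_le_ofReal_iff (integral_nonneg hn), ofReal_integral_cube hc hn]
  refine s0.trans_eq (lintegral_congr fun y => ?_)
  simp only [he, mixedSum]
  repeat rw [ENNReal.ofReal_add (by positivity) (by positivity)]

lemma measureReal_cube : (volume : Measure (Spc 3)).real (cube 3) = 1 := by
  rw [Measure.real, cube_eq_Icc, Real.volume_Icc_pi]
  simp

lemma sq_integral_le_integral_sq {g : Spc 3 → ℝ} (hg : Continuous g) :
    (∫ x in cube 3, g x) ^ 2 ≤ ∫ x in cube 3, g x ^ 2 := by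
  set m := ∫ x in cube 3, g x with hm
  have h : 0 ≤ ∫ x in cube 3, (g x - m) ^ 2 := integral_nonneg fun x => sq_nonneg _
  have h4 : ∫ x in cube 3, (g x - m) ^ 2 = (∫ x in cube 3, g x ^ 2) - 2 * m * m + m ^ 2 := by
    have : ∀ x, (g x - m) ^ 2 = g x ^ 2 - 2 * m * g x + m ^ 2 := fun x => by ring
    simp_rw [this]
    rw [integral_cube_add (by fun_prop) (by fun_prop), integral_cube_sub (by fun_prop) (by fun_prop),
      integral_const_mul, ← hm, setIntegral_const, measureReal_cube, one_smul]
  nlinarith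

/-- `L²` control of the mixed derivatives bounds the sup norm. -/
lemma sq_le_integral_sq_mixed (hf : SmoothPer f) (x : Spc 3) :
    f x ^ 2 ≤ 8 * ∫ y in cube 3, (((f y ^ 2 + pd 2 f y ^ 2)
      + (pd 1 f y ^ 2 + pd 2 (pd 1 f) y ^ 2))
      + ((pd 0 f y ^ 2 + pd 2 (pd 0 f) y ^ 2)
      + (pd 1 (pd 0 f) y ^ 2 + pd 2 (pd 1 (pd 0 f)) y ^ 2))) := by
  have h0 := hf.continuous
  have h1 := (hf.pd 0).continuous
  have h2 := (hf.pd 1).continuous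
  have h3 := (hf.pd 2).continuous
  have h4 := ((hf.pd 1).pd 2).continuous
  have h5 := ((hf.pd 0).pd 2).continuous
  have h6 := ((hf.pd 0).pd 1).continuous
  have h7 := (((hf.pd 0).pd 1).pd 2).continuous
  have hc : Continuous (mixedSum f) := by
    unfold mixedSum
    fun_prop
  calc f x ^ 2 = |f x| ^ 2 := (sq_abs _).symm
    _ ≤ (∫ y in cube 3, mixedSum f y) ^ 2 :=
        pow_le_pow_left₀ (abs_nonneg _) (abs_le_integral_mixedSum hf x) 2
    _ ≤ ∫ y in cube 3, mixedSum f y ^ 2 := sq_integral_le_integral_sq hc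
    _ ≤ _ := by
        rw [← integral_const_mul]
        refine integral_cube_mono (by fun_prop) (by fun_prop) fun y => ?_
        have key : ∀ a b c d p q r s : ℝ, (((a + b) + (c + d)) + ((p + q) + (r + s))) ^ 2
            ≤ 8 * (((a ^ 2 + b ^ 2) + (c ^ 2 + d ^ 2)) + ((p ^ 2 + q ^ 2) + (r ^ 2 + s ^ 2))) := by
          intro a b c d p q r s
          have e : ∀ u v : ℝ, (u + v) ^ 2 ≤ 2 * (u ^ 2 + v ^ 2) := fun u v => by
            nlinarith [sq_nonneg (u - v)]
          linarith [e a b, e c d, e p q, e r s, e (a + b) (c + d), e (p + q) (r + s),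
            e ((a + b) + (c + d)) ((p + q) + (r + s))]
        have := key |f y| |pd 2 f y| |pd 1 f y| |pd 2 (pd 1 f) y| |pd 0 f y|
          |pd 2 (pd 0 f) y| |pd 1 (pd 0 f) y| |pd 2 (pd 1 (pd 0 f)) y|
        simpa only [sq_abs, mixedSum] using this

/-- Gagliardo–Nirenberg type inequality for the exponent three on the torus. -/
lemma lintegral_rpow_le_rpow_lintegral (hf : SmoothPer f) :
    ∫⁻ x in cube 3, ENNReal.ofReal (f x ^ 2) ^ (3 / 2 : ℝ)
      ≤ (∫⁻ x in cube 3, ENNReal.ofReal (2 * f x ^ 2 + ∑ i, pd i f x ^ 2)) ^ (3 / 2 : ℝ) := by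
  have hc : Continuous fun x => 2 * f x ^ 2 + ∑ i, pd i f x ^ 2 := by
    have := hf.continuous
    have := fun i => (hf.pd i).continuous
    fun_prop
  have hconj : Real.HolderConjugate (Fintype.card (Fin 3)) (3 / 2 : ℝ) := by
    rw [Real.holderConjugate_iff]
    norm_num
  have key := lintegral_prod_lintegral_pow_le
    (μ := fun _ : Fin 3 => (volume : Measure ℝ).restrict (Set.Icc 0 1)) hconj
    (ENNReal.continuous_ofReal.comp hc).measurable
  rw [← volume_restrict_cube] at key
  refine le_trans (lintegral_mono fun x => ?_) key
  have hpt : ∀ i : Fin 3, ENNReal.ofReal (f x ^ 2) ≤ ∫⁻ s in Set.Icc (0 : ℝ) 1,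
      ENNReal.ofReal (2 * f (Function.update x i s) ^ 2
        + ∑ j, pd j f (Function.update x i s) ^ 2) := by
    intro i
    have h1 := enorm_le_lintegral_update (hf.pow 2) i x
    rw [abs_of_nonneg (sq_nonneg _)] at h1
    refine h1.trans (lintegral_mono fun s => ?_)
    rw [← ENNReal.ofReal_add (abs_nonneg _) (abs_nonneg _)]
    refine ENNReal.ofReal_le_ofReal ?_
    set y := Function.update x i s
    have h2 : pd i (fun z => f z ^ 2) y = 2 * (f y * pd i f y) := by
      have : (fun z => f z ^ 2) = fun z => f z * f z := funext fun z => sq _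
      rw [this, pd_mul hf hf]
      ring
    have h3 : pd i f y ^ 2 ≤ ∑ j, pd j f y ^ 2 :=
      Finset.single_le_sum (f := fun j => pd j f y ^ 2) (fun j _ => sq_nonneg _)
        (Finset.mem_univ i)
    have h4 : |2 * (f y * pd i f y)| ≤ f y ^ 2 + pd i f y ^ 2 := by
      rw [abs_le]
      constructor <;> nlinarith [sq_nonneg (f y - pd i f y), sq_nonneg (f y + pd i f y)]
    rw [h2, abs_of_nonneg (sq_nonneg _)]
    linarith
  calc ENNReal.ofReal (f x ^ 2) ^ (3 / 2 : ℝ)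
      = ∏ _i : Fin 3, ENNReal.ofReal (f x ^ 2) ^ (1 / 2 : ℝ) := by
        rw [Finset.prod_const, ← ENNReal.rpow_natCast, ← ENNReal.rpow_mul]
        norm_num
    _ ≤ _ := by
        refine Finset.prod_le_prod' fun i _ => ?_
        have : (1 / 2 : ℝ) = 1 / ((Fintype.card (Fin 3) : ℝ) - 1) := by norm_num
        rw [← this]
        exact ENNReal.rpow_le_rpow (hpt i) (by norm_num)

lemma integral_mul_sq_le {a : Spc 3 → ℝ} (ha : Continuous a) (ha0 : ∀ x, 0 ≤ a x) {κ : ℝ}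
    (hκ : 0 ≤ κ) (hint : ∫ x in cube 3, a x ^ 3 ≤ κ ^ 3) (hf : SmoothPer f) :
    ∫ x in cube 3, a x * f x ^ 2
      ≤ κ * ∫ x in cube 3, (2 * f x ^ 2 + ∑ i, pd i f x ^ 2) := by
  have hfc := hf.continuous
  have hc : Continuous fun x => 2 * f x ^ 2 + ∑ i, pd i f x ^ 2 := by
    have := fun i => (hf.pd i).continuous
    fun_prop
  have hc0 : ∀ x, 0 ≤ 2 * f x ^ 2 + ∑ i, pd i f x ^ 2 := fun x => by positivity
  have hconj : (3 : ℝ).HolderConjugate (3 / 2 : ℝ) := by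
    rw [Real.holderConjugate_iff]
    norm_num
  have h1 := ENNReal.lintegral_mul_le_Lp_mul_Lq ((volume : Measure (Spc 3)).restrict (cube 3))
    hconj (f := fun x => ENNReal.ofReal (a x)) (g := fun x => ENNReal.ofReal (f x ^ 2))
    (ENNReal.continuous_ofReal.comp ha).measurable.aemeasurable
    (show Continuous fun x => ENNReal.ofReal (f x ^ 2) from
      ENNReal.continuous_ofReal.comp (hfc.pow 2)).measurable.aemeasurable
  have h2 : (∫⁻ x in cube 3, ENNReal.ofReal (a x) ^ (3 : ℝ)) ^ (1 / 3 : ℝ)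
      ≤ ENNReal.ofReal κ := by
    have e1 : ∫⁻ x in cube 3, ENNReal.ofReal (a x) ^ (3 : ℝ)
        = ENNReal.ofReal (∫ x in cube 3, a x ^ 3) := by
      rw [ofReal_integral_cube (by fun_prop) fun x => pow_nonneg (ha0 x) 3]
      refine lintegral_congr fun x => ?_
      rw [ENNReal.ofReal_pow (ha0 x)]
      exact_mod_cast ENNReal.rpow_natCast _ 3
    calc _ ≤ (ENNReal.ofReal (κ ^ 3)) ^ (1 / 3 : ℝ) := by
          rw [e1]
          exact ENNReal.rpow_le_rpow (ENNReal.ofReal_le_ofReal hint) (by norm_num)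
      _ = ENNReal.ofReal κ := by
          rw [ENNReal.ofReal_pow hκ, ← ENNReal.rpow_natCast, ← ENNReal.rpow_mul]
          norm_num
  have h3 : (∫⁻ x in cube 3, ENNReal.ofReal (f x ^ 2) ^ (3 / 2 : ℝ)) ^ (1 / (3 / 2) : ℝ)
      ≤ ENNReal.ofReal (∫ x in cube 3, (2 * f x ^ 2 + ∑ i, pd i f x ^ 2)) := by
    rw [ofReal_integral_cube hc hc0]
    refine (ENNReal.rpow_le_rpow (lintegral_rpow_le_rpow_lintegral hf) (by norm_num)).trans_eq ?_
    rw [← ENNReal.rpow_mul]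
    norm_num
  rw [← ENNReal.ofReal_le_ofReal_iff (mul_nonneg hκ (integral_nonneg hc0)),
    ENNReal.ofReal_mul hκ,
    ofReal_integral_cube (by fun_prop) fun x => mul_nonneg (ha0 x) (sq_nonneg _)]
  calc ∫⁻ x in cube 3, ENNReal.ofReal (a x * f x ^ 2)
      = ∫⁻ x in cube 3, ((fun x => ENNReal.ofReal (a x)) * fun x => ENNReal.ofReal (f x ^ 2)) x :=
        lintegral_congr fun x => by simp [ENNReal.ofReal_mul (ha0 x)]
    _ ≤ _ := h1.trans (mul_le_mul' h2 h3)

end Sobolev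

section VectorCalculus

/-- Vector fields with smooth periodic components. -/
def SmoothPerV (v : Spc 3 → Vec 3) : Prop := ∀ a, SmoothPer fun x => v x a

variable {v w z : Spc 3 → Vec 3}

lemma SmoothPerV.sub (hv : SmoothPerV v) (hw : SmoothPerV w) :
    SmoothPerV fun x a => v x a - w x a := fun a => (hv a).sub (hw a)

lemma SmoothPerV.curl3 (hv : SmoothPerV v) : SmoothPerV (curl3 v) := by
  intro a
  fin_cases a
  · exact ((hv 2).pd 1).sub ((hv 1).pd 2)
  · exact ((hv 0).pd 2).sub ((hv 2).pd 0)
  · exact ((hv 1).pd 0).sub ((hv 0).pd 1)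

lemma SmoothPerV.divv (hv : SmoothPerV v) : SmoothPer (divv v) :=
  SmoothPer.sum _ fun i _ => (hv i).pd i

lemma SmoothPerV.divM_tens (hv : SmoothPerV v) : SmoothPerV (divM (tens v v)) := fun i =>
  SmoothPer.sum _ fun j _ => ((hv i).mul (hv j)).pd j

lemma SmoothPerV.continuous_ptsq (hv : SmoothPerV v) : Continuous (ptsq v) :=
  continuous_finsetSum _ fun a _ => (hv a).continuous.pow 2

lemma SmoothPerV.continuous_ptsqD1 (hv : SmoothPerV v) : Continuous (ptsqD1 v) :=
  continuous_finsetSum _ fun a _ => continuous_finsetSum _ fun i _ =>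
    ((hv a).pd i).continuous.pow 2

lemma curl3_sub (hv : SmoothPerV v) (hw : SmoothPerV w) (x : Spc 3) (a : Fin 3) :
    curl3 (fun y b => v y b - w y b) x a = curl3 v x a - curl3 w x a := by
  fin_cases a <;> simp [curl3, pd_sub (hv _) (hw _)] <;> ring

lemma curl3_grad {q : Spc 3 → ℝ} (hq : SmoothPer q) (x : Spc 3) (a : Fin 3) :
    curl3 (fun y b => pd b q y) x a = 0 := by
  fin_cases a <;> simp [curl3, sub_eq_zero] <;> exact pd_comm hq _ _ x

lemma integral_mul_curl3 (hv : SmoothPerV v) (hw : SmoothPerV w) :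
    ∫ x in cube 3, ∑ a, v x a * curl3 w x a = ∫ x in cube 3, ∑ a, curl3 v x a * w x a := by
  have hc1 : Continuous fun x => ∑ a, v x a * curl3 w x a :=
    continuous_finsetSum _ fun a _ => (hv a).continuous.mul (hw.curl3 a).continuous
  have hc2 : Continuous fun x => ∑ a, curl3 v x a * w x a :=
    continuous_finsetSum _ fun a _ => (hv.curl3 a).continuous.mul (hw a).continuous
  have h0 := ((hw 1).mul (hv 2)).sub ((hw 2).mul (hv 1))
  have h1 := ((hw 2).mul (hv 0)).sub ((hw 0).mul (hv 2))
  have h2 := ((hw 0).mul (hv 1)).sub ((hw 1).mul (hv 0))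
  have key : ∀ x, (∑ a, v x a * curl3 w x a) - ∑ a, curl3 v x a * w x a
      = pd 0 (fun y => w y 1 * v y 2 - w y 2 * v y 1) x
        + pd 1 (fun y => w y 2 * v y 0 - w y 0 * v y 2) x
        + pd 2 (fun y => w y 0 * v y 1 - w y 1 * v y 0) x := by
    intro x
    rw [pd_sub ((hw 1).mul (hv 2)) ((hw 2).mul (hv 1)),
      pd_sub ((hw 2).mul (hv 0)) ((hw 0).mul (hv 2)),
      pd_sub ((hw 0).mul (hv 1)) ((hw 1).mul (hv 0)),
      pd_mul (hw 1) (hv 2), pd_mul (hw 2) (hv 1), pd_mul (hw 2) (hv 0), pd_mul (hw 0) (hv 2),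
      pd_mul (hw 0) (hv 1), pd_mul (hw 1) (hv 0)]
    simp [curl3, Fin.sum_univ_three]
    ring
  rw [← sub_eq_zero, ← integral_cube_sub hc1 hc2]
  simp_rw [key]
  have c0 := (h0.pd 0).continuous
  have c1 := (h1.pd 1).continuous
  have c2 := (h2.pd 2).continuous
  rw [integral_cube_add (by fun_prop) c2, integral_cube_add c0 c1, integral_pd_eq_zero h0,
    integral_pd_eq_zero h1, integral_pd_eq_zero h2]
  simp

/-- The part of `∇·(v ⊗ v) - ∇·(u ⊗ u)` left after removing a gradient, for `∇·u = 0`. -/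
def lambVec (v u : Spc 3 → Vec 3) (x : Spc 3) : Vec 3 := fun a =>
  divv v x * v x a
    + crossProduct (fun b => curl3 v x b - curl3 u x b) (v x) a
    + crossProduct (curl3 u x) (fun b => v x b - u x b) a

variable {u : Spc 3 → Vec 3}

lemma SmoothPerV.lambVec (hv : SmoothPerV v) (hu : SmoothPerV u) : SmoothPerV (lambVec v u) := by
  have hc : ∀ {f g : Spc 3 → Vec 3}, SmoothPerV f → SmoothPerV g →
      SmoothPerV fun x => crossProduct (f x) (g x) := by
    intro f g hf hg a
    simp only [cross_apply]
    fin_cases a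
    · exact ((hf 1).mul (hg 2)).sub ((hf 2).mul (hg 1))
    · exact ((hf 2).mul (hg 0)).sub ((hf 0).mul (hg 2))
    · exact ((hf 0).mul (hg 1)).sub ((hf 1).mul (hg 0))
  exact fun a => ((hv.divv.mul (hv a)).add (hc (hv.curl3.sub hu.curl3) hv a)).add
    (hc hu.curl3 (hv.sub hu) a)

lemma divM_tens_sub (hv : SmoothPerV v) (hu : SmoothPerV u) (hdiv : ∀ x, divv u x = 0)
    (x : Spc 3) (a : Fin 3) :
    divM (tens v v) x a - divM (tens u u) x a = lambVec v u x a
      + pd a (fun y => ∑ b, (v y b * v y b - u y b * u y b) * (1 / 2)) x := by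
  have hq : pd a (fun y => ∑ b, (v y b * v y b - u y b * u y b) * (1 / 2)) x
      = ∑ b, (v x b * pd a (fun y => v y b) x - u x b * pd a (fun y => u y b) x) := by
    have hd : ∀ b, SmoothPer fun y => (v y b * v y b - u y b * u y b) * (1 / 2) := fun b =>
      (((hv b).mul (hv b)).sub ((hu b).mul (hu b))).mul (SmoothPer.const _)
    simp only [Fin.sum_univ_three]
    rw [pd_add ((hd 0).add (hd 1)) (hd 2), pd_add (hd 0) (hd 1)]
    have : ∀ b, pd a (fun y => (v y b * v y b - u y b * u y b) * (1 / 2)) x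
        = v x b * pd a (fun y => v y b) x - u x b * pd a (fun y => u y b) x := by
      intro b
      rw [pd_mul (((hv b).mul (hv b)).sub ((hu b).mul (hu b))) (SmoothPer.const _),
        pd_sub ((hv b).mul (hv b)) ((hu b).mul (hu b)), pd_mul (hv b) (hv b),
        pd_mul (hu b) (hu b)]
      have : pd a (fun _ : Spc 3 => (1 / 2 : ℝ)) x = 0 := by simp [pd]
      rw [this]
      ring
    rw [this, this, this]
  have hd := hdiv x
  rw [hq]
  simp only [divM, tens, lambVec, divv, Fin.sum_univ_three, cross_apply, curl3, pd_mul (hv _) (hv _),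
    pd_mul (hu _) (hu _)] at hd ⊢
  fin_cases a
  · simp
    linear_combination -u x 0 * hd
  · simp
    linear_combination -u x 1 * hd
  · simp
    linear_combination -u x 2 * hd

/-- The gradient part of the nonlinearity does not contribute to the enstrophy production. -/
lemma integral_mul_Af_sub (hv : SmoothPerV v) (hu : SmoothPerV u) (hdiv : ∀ x, divv u x = 0)
    (hz : SmoothPerV z) :
    ∫ x in cube 3, ∑ a, z x a * (Af v x a - Af u x a)
      = ∫ x in cube 3, ∑ a, curl3 z x a * lambVec v u x a := by
  set q : Spc 3 → ℝ := fun y => ∑ b, (v y b * v y b - u y b * u y b) * (1 / 2) with hqdef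
  have hq : SmoothPer q := SmoothPer.sum _ fun b _ =>
    (((hv b).mul (hv b)).sub ((hu b).mul (hu b))).mul (SmoothPer.const _)
  have hG := hv.lambVec hu
  have h1 : ∀ x a, Af v x a - Af u x a
      = curl3 (fun y b => divM (tens v v) y b - divM (tens u u) y b) x a := fun x a =>
    (curl3_sub hv.divM_tens hu.divM_tens x a).symm
  simp_rw [h1]
  rw [integral_mul_curl3 hz (hv.divM_tens.sub hu.divM_tens)]
  simp_rw [divM_tens_sub hv hu hdiv, mul_add, Finset.sum_add_distrib]
  have hc1 : Continuous fun x => ∑ a, curl3 z x a * lambVec v u x a :=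
    continuous_finsetSum _ fun a _ => (hz.curl3 a).continuous.mul (hG a).continuous
  have hc2 : Continuous fun x => ∑ a, curl3 z x a * pd a q x :=
    continuous_finsetSum _ fun a _ => (hz.curl3 a).continuous.mul (hq.pd a).continuous
  rw [integral_cube_add hc1 hc2]
  have h2 : ∫ x in cube 3, ∑ a, curl3 z x a * pd a q x = 0 := by
    rw [← integral_mul_curl3 hz (w := fun y b => pd b q y) fun b => hq.pd b]
    simp [curl3_grad hq]
  rw [h2, add_zero]

lemma sum_sq_curl3_le (z : Spc 3 → Vec 3) (x : Spc 3) :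
    ∑ a, curl3 z x a ^ 2 ≤ 2 * ptsqD1 z x := by
  simp only [ptsqD1, curl3, Fin.sum_univ_three]
  simp
  nlinarith [sq_nonneg (pd 1 (fun y => z y 2) x + pd 2 (fun y => z y 1) x),
    sq_nonneg (pd 2 (fun y => z y 0) x + pd 0 (fun y => z y 2) x),
    sq_nonneg (pd 0 (fun y => z y 1) x + pd 1 (fun y => z y 0) x),
    sq_nonneg (pd 0 (fun y => z y 0) x), sq_nonneg (pd 1 (fun y => z y 1) x),
    sq_nonneg (pd 2 (fun y => z y 2) x)]

lemma sum_sq_cross_le (a b : Vec 3) :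
    ∑ i, crossProduct a b i ^ 2 ≤ (∑ i, a i ^ 2) * ∑ i, b i ^ 2 := by
  simp only [cross_apply, Fin.sum_univ_three]
  simp
  nlinarith [sq_nonneg (a 0 * b 0 + a 1 * b 1 + a 2 * b 2)]

end VectorCalculus

section CoreEstimate

variable {u v w z : Spc 3 → Vec 3}

lemma integral_mul_ptsq_le {a : Spc 3 → ℝ} (ha : Continuous a) (ha0 : ∀ x, 0 ≤ a x) {κ : ℝ}
    (hκ : 0 ≤ κ) (hint : ∫ x in cube 3, a x ^ 3 ≤ κ ^ 3) (hz : SmoothPerV z) :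
    ∫ x in cube 3, a x * ptsq z x ≤ κ * (2 * L2sq z + D1L2sq z) := by
  have hc : ∀ b : Fin 3, Continuous fun x => ∑ i, pd i (fun y => z y b) x ^ 2 := fun b =>
    continuous_finsetSum _ fun i _ => ((hz b).pd i).continuous.pow 2
  have hzc : ∀ b : Fin 3, Continuous fun x => z x b := fun b => (hz b).continuous
  have e1 : ∫ x in cube 3, a x * ptsq z x = ∑ b, ∫ x in cube 3, a x * z x b ^ 2 := by
    simp only [ptsq, Finset.mul_sum]
    exact integral_finsetSum _ fun b _ =>
      integrableOn_cube (f := fun x => a x * z x b ^ 2) (ha.mul ((hzc b).pow 2))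
  have e2 : 2 * L2sq z + D1L2sq z
      = ∑ b, ∫ x in cube 3, (2 * z x b ^ 2 + ∑ i, pd i (fun y => z y b) x ^ 2) := by
    rw [← integral_finsetSum _ fun b _ => integrableOn_cube
      (f := fun x => 2 * z x b ^ 2 + ∑ i, pd i (fun y => z y b) x ^ 2)
      ((((hzc b).pow 2).const_mul 2).add (hc b))]
    simp only [Finset.sum_add_distrib, ← Finset.mul_sum]
    have h1 := hz.continuous_ptsq
    have h2 := hz.continuous_ptsqD1
    have := integral_cube_add (f := fun x => 2 * ptsq z x) (h1.const_mul 2) h2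
    rw [integral_const_mul] at this
    exact this.symm
  rw [e1, e2, Finset.mul_sum]
  exact Finset.sum_le_sum fun b _ => integral_mul_sq_le ha ha0 hκ hint (hz b)

lemma ptsq_nonneg {ι : Type*} [Fintype ι] (f : Spc 3 → ι → ℝ) (x : Spc 3) : 0 ≤ ptsq f x :=
  Finset.sum_nonneg fun _ _ => sq_nonneg _

lemma ptsqD1_nonneg {ι : Type*} [Fintype ι] (f : Spc 3 → ι → ℝ) (x : Spc 3) : 0 ≤ ptsqD1 f x :=
  Finset.sum_nonneg fun _ _ => Finset.sum_nonneg fun _ _ => sq_nonneg _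

lemma L2sq_nonneg {ι : Type*} [Fintype ι] (f : Spc 3 → ι → ℝ) : 0 ≤ L2sq f :=
  integral_nonneg fun x => ptsq_nonneg f x

lemma D1L2sq_nonneg {ι : Type*} [Fintype ι] (f : Spc 3 → ι → ℝ) : 0 ≤ D1L2sq f :=
  integral_nonneg fun x => ptsqD1_nonneg f x

/-- Interpolation of `‖curl w‖` between `‖w‖` and `‖∇ curl w‖` in `L²`. -/
lemma L2sq_curl3_le (hw : SmoothPerV w) {l : ℝ} (hl : 0 < l) :
    L2sq (curl3 w) ≤ l * D1L2sq (curl3 w) + 1 / (2 * l) * L2sq w := by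
  have hz := hw.curl3
  have e : L2sq (curl3 w) = ∫ x in cube 3, ∑ a, w x a * curl3 (curl3 w) x a := by
    rw [integral_mul_curl3 hw hz]
    simp only [L2sq, ptsq, sq]
  have h1 := hz.continuous_ptsqD1
  have h2 := hw.continuous_ptsq
  have hc : Continuous fun x => ∑ a, w x a * curl3 (curl3 w) x a :=
    continuous_finsetSum _ fun a _ => (hw a).continuous.mul (hz.curl3 a).continuous
  rw [e, D1L2sq, L2sq, ← integral_const_mul, ← integral_const_mul,
    ← integral_cube_add (h1.const_mul l) (h2.const_mul _)]
  refine integral_cube_mono hc ((h1.const_mul l).add (h2.const_mul _)) fun x => ?_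
  have h3 : ∑ a, w x a * curl3 (curl3 w) x a
      ≤ ∑ a, (1 / (2 * l) * w x a ^ 2 + l / 2 * curl3 (curl3 w) x a ^ 2) := by
    refine Finset.sum_le_sum fun a _ => ?_
    have : 1 / (2 * l) * w x a ^ 2 + l / 2 * curl3 (curl3 w) x a ^ 2
        - w x a * curl3 (curl3 w) x a = 1 / (2 * l) * (w x a - l * curl3 (curl3 w) x a) ^ 2 := by
      field_simp
      ring
    have h4 : 0 ≤ 1 / (2 * l) * (w x a - l * curl3 (curl3 w) x a) ^ 2 := by positivity
    linarith
  rw [Finset.sum_add_distrib, ← Finset.mul_sum, ← Finset.mul_sum] at h3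
  have h5 := mul_le_mul_of_nonneg_left (sum_sq_curl3_le (curl3 w) x) (half_pos hl).le
  simp only [ptsq] at *
  linarith

lemma sum_sq_lambVec_le (v u : Spc 3 → Vec 3) (x : Spc 3) :
    ∑ a, lambVec v u x a ^ 2
      ≤ 4 * (ptsq v x * divv v x ^ 2
        + ptsq (fun y b => curl3 v y b - curl3 u y b) x * ptsq u x
        + ptsq (fun y b => curl3 v y b - curl3 u y b) x * ptsq (fun y b => v y b - u y b) x
        + ptsq (curl3 u) x * ptsq (fun y b => v y b - u y b) x) := by
  set ζ : Vec 3 := fun b => curl3 v x b - curl3 u x b with hζ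
  set ω : Vec 3 := fun b => v x b - u x b with hω
  have hv : v x = u x + ω := by
    funext b
    simp [hω]
  have h1 := sum_sq_cross_le ζ (u x)
  have h2 := sum_sq_cross_le ζ ω
  have h3 := sum_sq_cross_le (curl3 u x) ω
  have h4 : ∑ a, lambVec v u x a ^ 2 ≤ ∑ a, 4 * ((divv v x * v x a) ^ 2
      + crossProduct ζ (u x) a ^ 2 + crossProduct ζ ω a ^ 2
      + crossProduct (curl3 u x) ω a ^ 2) := by
    refine Finset.sum_le_sum fun a _ => ?_
    have e : lambVec v u x a = divv v x * v x a + crossProduct ζ (u x) a + crossProduct ζ ω a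
        + crossProduct (curl3 u x) ω a := by
      have : crossProduct ζ (v x) a = crossProduct ζ (u x) a + crossProduct ζ ω a := by
        rw [hv, map_add]
        rfl
      simp only [lambVec]
      rw [← hζ, ← hω, this]
      ring
    rw [e]
    generalize divv v x * v x a = p
    generalize crossProduct ζ (u x) a = q
    generalize crossProduct ζ ω a = r
    generalize crossProduct (curl3 u x) ω a = s
    nlinarith [sq_nonneg (p - q), sq_nonneg (p - r), sq_nonneg (p - s), sq_nonneg (q - r),
      sq_nonneg (q - s), sq_nonneg (r - s)]
  refine h4.trans ?_
  rw [← Finset.mul_sum]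
  simp only [Finset.sum_add_distrib, mul_pow, ← Finset.mul_sum]
  simp only [ptsq]
  linarith

/-- The enstrophy-production estimate, under pointwise bounds on both fields and smallness of
their `L²` distance. -/
lemma abs_integral_curl_mul_Af_sub_le (hv : SmoothPerV v) (hu : SmoothPerV u)
    (hdiv : ∀ x, divv u x = 0) {M B m : ℝ} (hM : 0 ≤ M) (hB : 0 < B) (hm : 0 ≤ m)
    (hvM : ∀ x, ptsq v x ≤ M) (huB : ∀ x, ptsq u x ≤ B)
    (hcu : ∀ x, ptsq (curl3 u) x ≤ 8 * B ^ 2) (hdv : L2sq (sc (divv v)) ≤ m)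
    (hw2 : L2sq (fun x b => v x b - u x b) ≤ m)
    (hsmall : (2 * M + 2 * B) ^ 2 * m ≤ (1 / 400) ^ 3) :
    |-∫ x in cube 3, ∑ a, (curl3 v x a - curl3 u x a) * (Af v x a - Af u x a)|
      ≤ 7 / 10 * D1L2sq (fun x b => curl3 v x b - curl3 u x b)
        + (8 * M + 384 * B ^ 2 + 1) * m := by
  set w : Spc 3 → Vec 3 := fun x b => v x b - u x b with hwdef
  set z : Spc 3 → Vec 3 := fun x b => curl3 v x b - curl3 u x b with hzdef
  have hw : SmoothPerV w := hv.sub hu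
  have hz : SmoothPerV z := hv.curl3.sub hu.curl3
  have hzw : curl3 w = z := by
    funext x a
    exact curl3_sub hv hu x a
  have hG := hv.lambVec hu
  set X := D1L2sq z with hX
  set Z := L2sq z with hZ
  have hX0 : 0 ≤ X := D1L2sq_nonneg z
  have hI : ∫ x in cube 3, ∑ a, (curl3 v x a - curl3 u x a) * (Af v x a - Af u x a)
      = ∫ x in cube 3, ∑ a, curl3 z x a * lambVec v u x a := integral_mul_Af_sub hv hu hdiv hz
  rw [abs_neg, hI]
  have cw := hw.continuous_ptsq
  have cz := hz.continuous_ptsq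
  have cz1 := hz.continuous_ptsqD1
  have cD : Continuous fun x => divv v x ^ 2 := hv.divv.continuous.pow 2
  have hpt : ∀ x, |∑ a, curl3 z x a * lambVec v u x a|
      ≤ 1 / 4 * ptsqD1 z x + (8 * M * divv v x ^ 2 + (8 * B * ptsq z x
        + (8 * (ptsq w x * ptsq z x) + 64 * B ^ 2 * ptsq w x))) := by
    intro x
    have h1 : |∑ a, curl3 z x a * lambVec v u x a|
        ≤ ∑ a, (1 / 8 * curl3 z x a ^ 2 + 2 * lambVec v u x a ^ 2) := by
      refine (Finset.abs_sum_le_sum_abs _ _).trans (Finset.sum_le_sum fun a _ => ?_)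
      rw [abs_le]
      constructor <;> nlinarith [sq_nonneg (curl3 z x a - 4 * lambVec v u x a),
        sq_nonneg (curl3 z x a + 4 * lambVec v u x a)]
    rw [Finset.sum_add_distrib, ← Finset.mul_sum, ← Finset.mul_sum] at h1
    have h2 := sum_sq_curl3_le z x
    have h3 : ∑ a, lambVec v u x a ^ 2 ≤ 4 * (ptsq v x * divv v x ^ 2 + ptsq z x * ptsq u x
        + ptsq z x * ptsq w x + ptsq (curl3 u) x * ptsq w x) := sum_sq_lambVec_le v u x
    have h4 := mul_le_mul_of_nonneg_right (hvM x) (sq_nonneg (divv v x))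
    have h5 := mul_le_mul_of_nonneg_left (huB x) (ptsq_nonneg z x)
    have h6 := mul_le_mul_of_nonneg_right (hcu x) (ptsq_nonneg w x)
    linarith
  have c0 : Continuous fun x => 8 * (ptsq w x * ptsq z x) := by fun_prop
  have c1 : Continuous fun x => 8 * (ptsq w x * ptsq z x) + 64 * B ^ 2 * ptsq w x := by fun_prop
  have c2 : Continuous fun x => 8 * B * ptsq z x
      + (8 * (ptsq w x * ptsq z x) + 64 * B ^ 2 * ptsq w x) := by fun_prop
  have c3 : Continuous fun x => 8 * M * divv v x ^ 2 + (8 * B * ptsq z x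
      + (8 * (ptsq w x * ptsq z x) + 64 * B ^ 2 * ptsq w x)) := by fun_prop
  have c4 : Continuous fun x => 1 / 4 * ptsqD1 z x + (8 * M * divv v x ^ 2 + (8 * B * ptsq z x
      + (8 * (ptsq w x * ptsq z x) + 64 * B ^ 2 * ptsq w x))) := by fun_prop
  have hc : Continuous fun x => ∑ a, curl3 z x a * lambVec v u x a :=
    continuous_finsetSum _ fun a _ => (hz.curl3 a).continuous.mul (hG a).continuous
  have hmain : |∫ x in cube 3, ∑ a, curl3 z x a * lambVec v u x a|
      ≤ 1 / 4 * X + (8 * M * (∫ x in cube 3, divv v x ^ 2) + (8 * B * Z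
        + (8 * (∫ x in cube 3, ptsq w x * ptsq z x) + 64 * B ^ 2 * L2sq w))) := by
    refine abs_integral_le_integral_abs.trans
      ((integral_cube_mono hc.abs c4 hpt).trans_eq ?_)
    rw [integral_cube_add (cz1.const_mul _) c3, integral_cube_add (cD.const_mul _) c2,
      integral_cube_add (cz.const_mul _) c1,
      integral_cube_add c0 (cw.const_mul _)]
    simp only [integral_const_mul]
    rfl
  have hdv' : ∫ x in cube 3, divv v x ^ 2 ≤ m := by simpa [L2sq, ptsq, sc] using hdv
  have hwB : ∀ x, ptsq w x ≤ 2 * M + 2 * B := by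
    intro x
    have h1 : ptsq w x ≤ 2 * ptsq v x + 2 * ptsq u x := by
      simp only [ptsq, Finset.mul_sum, ← Finset.sum_add_distrib]
      exact Finset.sum_le_sum fun a _ => by nlinarith [sq_nonneg (v x a + u x a)]
    linarith [hvM x, huB x]
  have hcube : ∫ x in cube 3, ptsq w x ^ 3 ≤ (1 / 400) ^ 3 := by
    have h1 : ∫ x in cube 3, ptsq w x ^ 3 ≤ ∫ x in cube 3, (2 * M + 2 * B) ^ 2 * ptsq w x := by
      refine integral_cube_mono (cw.pow 3) (cw.const_mul _) fun x => ?_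
      have h2 := pow_le_pow_left₀ (ptsq_nonneg w x) (hwB x) 2
      calc ptsq w x ^ 3 = ptsq w x ^ 2 * ptsq w x := by ring
        _ ≤ _ := mul_le_mul_of_nonneg_right h2 (ptsq_nonneg w x)
    rw [integral_const_mul] at h1
    exact h1.trans ((mul_le_mul_of_nonneg_left hw2 (sq_nonneg _)).trans hsmall)
  have hint : ∫ x in cube 3, ptsq w x * ptsq z x ≤ 1 / 400 * (2 * Z + X) :=
    integral_mul_ptsq_le cw (ptsq_nonneg w) (by norm_num) hcube hz
  have hZ1 := L2sq_curl3_le hw (l := 1) one_pos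
  have hZ2 := L2sq_curl3_le hw (l := 1 / (80 * B)) (by positivity)
  rw [hzw] at hZ1 hZ2
  have hZ3 : 8 * B * Z ≤ 1 / 10 * X + 320 * B ^ 2 * m := by
    have h1 := mul_le_mul_of_nonneg_left hZ2 (by positivity : 0 ≤ 8 * B)
    have h2 : 8 * B * (1 / (80 * B) * D1L2sq z + 1 / (2 * (1 / (80 * B))) * L2sq w)
        = 1 / 10 * X + 320 * B ^ 2 * L2sq w := by
      field_simp
      ring
    rw [h2] at h1
    nlinarith [mul_le_mul_of_nonneg_left hw2 (sq_nonneg B)]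
  have hM1 := mul_le_mul_of_nonneg_left hdv' hM
  have hB1 := mul_le_mul_of_nonneg_left hw2 (sq_nonneg B)
  have hZ4 : Z ≤ X + 1 / 2 * m := by
    have : Z ≤ 1 * X + 1 / (2 * 1) * L2sq w := hZ1
    linarith
  linarith

end CoreEstimate

section SolutionBounds

lemma exists_forall_le_of_per {g : Spc 3 → ℝ} (hg : Continuous g) (hp : Per g) :
    ∃ x₀, ∀ x, g x ≤ g x₀ := by
  obtain ⟨x₀, -, h⟩ := isCompact_cube.exists_isMaxOn
    ⟨0, fun i _ => by simp⟩ hg.continuousOn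
  refine ⟨x₀, fun x => ?_⟩
  have e := hp x fun i => -⌊x i⌋
  rw [← e]
  refine h fun i _ => ?_
  have h1 : x i + ((-⌊x i⌋ : ℤ) : ℝ) = Int.fract (x i) := by
    rw [Int.fract]
    push_cast
    ring
  simp only [h1]
  exact ⟨Int.fract_nonneg _, (Int.fract_lt_one _).le⟩

lemma ptsq_le_H3sq {ι : Type*} [Fintype ι] {F : Spc 3 → ι → ℝ}
    (hF : ∀ a, SmoothPer fun x => F x a) (x : Spc 3) : ptsq F x ≤ 8 * H3sq F := by
  have c0 : Continuous (ptsq F) := continuous_finsetSum _ fun a _ => (hF a).continuous.pow 2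
  have c1 : Continuous (ptsqD1 F) := continuous_finsetSum _ fun a _ =>
    continuous_finsetSum _ fun i _ => ((hF a).pd i).continuous.pow 2
  have c2 : Continuous (ptsqD2 F) := continuous_finsetSum _ fun a _ =>
    continuous_finsetSum _ fun i _ => continuous_finsetSum _ fun j _ =>
      (((hF a).pd j).pd i).continuous.pow 2
  have c3 : Continuous (ptsqD3 F) := continuous_finsetSum _ fun a _ =>
    continuous_finsetSum _ fun i _ => continuous_finsetSum _ fun j _ =>
      continuous_finsetSum _ fun k _ => ((((hF a).pd k).pd j).pd i).continuous.pow 2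
  have c01 : Continuous fun x => ptsq F x + ptsqD1 F x := by fun_prop
  have c012 : Continuous fun x => ptsq F x + ptsqD1 F x + ptsqD2 F x := by fun_prop
  have c0123 : Continuous fun x => ptsq F x + ptsqD1 F x + ptsqD2 F x + ptsqD3 F x := by fun_prop
  have cm : ∀ a, Continuous fun y => (((F y a ^ 2 + pd 2 (fun x => F x a) y ^ 2)
      + (pd 1 (fun x => F x a) y ^ 2 + pd 2 (pd 1 fun x => F x a) y ^ 2))
      + ((pd 0 (fun x => F x a) y ^ 2 + pd 2 (pd 0 fun x => F x a) y ^ 2)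
      + (pd 1 (pd 0 fun x => F x a) y ^ 2 + pd 2 (pd 1 (pd 0 fun x => F x a)) y ^ 2))) := by
    intro a
    have d0 := (hF a).continuous
    have d1 := ((hF a).pd 2).continuous
    have d2 := ((hF a).pd 1).continuous
    have d3 := ((hF a).pd 0).continuous
    have d4 := (((hF a).pd 1).pd 2).continuous
    have d5 := (((hF a).pd 0).pd 2).continuous
    have d6 := (((hF a).pd 0).pd 1).continuous
    have d7 := ((((hF a).pd 0).pd 1).pd 2).continuous
    fun_prop
  have h1 : ptsq F x ≤ ∑ a, 8 * ∫ y in cube 3, (((F y a ^ 2 + pd 2 (fun x => F x a) y ^ 2)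
      + (pd 1 (fun x => F x a) y ^ 2 + pd 2 (pd 1 fun x => F x a) y ^ 2))
      + ((pd 0 (fun x => F x a) y ^ 2 + pd 2 (pd 0 fun x => F x a) y ^ 2)
      + (pd 1 (pd 0 fun x => F x a) y ^ 2 + pd 2 (pd 1 (pd 0 fun x => F x a)) y ^ 2))) :=
    Finset.sum_le_sum fun a _ => sq_le_integral_sq_mixed (hF a) x
  rw [← Finset.mul_sum, ← integral_finsetSum _ fun a _ => integrableOn_cube (cm a)] at h1
  refine h1.trans (mul_le_mul_of_nonneg_left ?_ (by norm_num))
  rw [H3sq, L2sq, D1L2sq, D2L2sq, D3L2sq, ← integral_cube_add c0 c1, ← integral_cube_add c01 c2,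
    ← integral_cube_add c012 c3]
  refine integral_cube_mono (continuous_finsetSum _ fun a _ => cm a) c0123 fun y => ?_
  simp only [ptsq, ptsqD1, ptsqD2, ptsqD3, ← Finset.sum_add_distrib]
  refine Finset.sum_le_sum fun a _ => ?_
  generalize (fun x => F x a) = f
  have s3 : pd 2 (pd 1 (pd 0 f)) y ^ 2 ≤ ∑ i, ∑ j, ∑ k, pd i (pd j (pd k f)) y ^ 2 := by
    refine le_trans ?_ (Finset.single_le_sum (f := fun i => ∑ j, ∑ k, pd i (pd j (pd k f)) y ^ 2)
      (fun i _ => by positivity) (Finset.mem_univ 2))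
    refine le_trans ?_ (Finset.single_le_sum (f := fun j => ∑ k, pd 2 (pd j (pd k f)) y ^ 2)
      (fun i _ => by positivity) (Finset.mem_univ 1))
    exact Finset.single_le_sum (f := fun k => pd 2 (pd 1 (pd k f)) y ^ 2)
      (fun i _ => by positivity) (Finset.mem_univ 0)
  have s2 : pd 2 (pd 1 f) y ^ 2 + pd 2 (pd 0 f) y ^ 2 + pd 1 (pd 0 f) y ^ 2
      ≤ ∑ i, ∑ j, pd i (pd j f) y ^ 2 := by
    simp only [Fin.sum_univ_three]
    linarith [sq_nonneg (pd 0 (pd 0 f) y), sq_nonneg (pd 0 (pd 1 f) y),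
      sq_nonneg (pd 0 (pd 2 f) y), sq_nonneg (pd 1 (pd 1 f) y), sq_nonneg (pd 1 (pd 2 f) y),
      sq_nonneg (pd 2 (pd 2 f) y)]
  have s1 : ∑ i, pd i f y ^ 2 = pd 0 f y ^ 2 + pd 1 f y ^ 2 + pd 2 f y ^ 2 := Fin.sum_univ_three _
  linarith

lemma SmoothS.pd {g : ℝ → Spc 3 → ℝ} (hg : SmoothS g) (i : Fin 3) :
    SmoothS fun t => pd i (g t) := by
  have h1 : ContDiff ℝ (⊤ : ℕ∞) (fderiv ℝ fun q : ℝ × Spc 3 => g q.1 q.2) :=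
    ContDiff.fderiv_right hg (by simp)
  have h2 : ContDiff ℝ (⊤ : ℕ∞) fun q : ℝ × Spc 3 =>
      fderiv ℝ (fun q : ℝ × Spc 3 => g q.1 q.2) q (0, Pi.single i 1) := h1.clm_apply contDiff_const
  have e : (fun q : ℝ × Spc 3 => NSRelax.pd i (g q.1) q.2) = fun q : ℝ × Spc 3 =>
      fderiv ℝ (fun q : ℝ × Spc 3 => g q.1 q.2) q (0, Pi.single i 1) := by
    funext q
    have hd : HasFDerivAt (fun q : ℝ × Spc 3 => g q.1 q.2)
        (fderiv ℝ (fun q : ℝ × Spc 3 => g q.1 q.2) (q.1, q.2)) (q.1, q.2) :=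
      (ContDiff.differentiable hg (by simp) _).hasFDerivAt
    have h3 := hd.comp q.2 (hasFDerivAt_prodMk_right q.1 q.2)
    have h4 : fderiv ℝ (g q.1) q.2 = _ := h3.fderiv
    simp [NSRelax.pd, h4]
  unfold SmoothS
  rw [e]
  exact h2

lemma SmoothS.slice {g : ℝ → Spc 3 → ℝ} (hg : SmoothS g) (t : ℝ) :
    ContDiff ℝ (⊤ : ℕ∞) (g t) :=
  ContDiff.comp (g := fun q : ℝ × Spc 3 => g q.1 q.2) hg (contDiff_prodMk_right t)

lemma SmoothS.continuous {g : ℝ → Spc 3 → ℝ} (hg : SmoothS g) :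
    Continuous fun q : ℝ × Spc 3 => g q.1 q.2 := ContDiff.continuous hg

lemma continuous_H3sq {ι : Type*} [Fintype ι] {F : ℝ → Spc 3 → ι → ℝ}
    (hF : ∀ a, SmoothS fun t x => F t x a) : Continuous fun t => H3sq (F t) := by
  have key : ∀ {G : ℝ → Spc 3 → ℝ}, (Continuous fun q : ℝ × Spc 3 => G q.1 q.2) →
      Continuous fun t => ∫ x in cube 3, G t x := fun {G} hG =>
    continuous_parametric_integral_of_continuous (f := G) hG isCompact_cube
  refine ((Continuous.add (key ?_) (key ?_)).add (key ?_)).add (key ?_)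
  · exact continuous_finsetSum _ fun a _ => (hF a).continuous.pow 2
  · exact continuous_finsetSum _ fun a _ => continuous_finsetSum _ fun i _ =>
      ((hF a).pd i).continuous.pow 2
  · exact continuous_finsetSum _ fun a _ => continuous_finsetSum _ fun i _ =>
      continuous_finsetSum _ fun j _ => (((hF a).pd j).pd i).continuous.pow 2
  · exact continuous_finsetSum _ fun a _ => continuous_finsetSum _ fun i _ =>
      continuous_finsetSum _ fun j _ => continuous_finsetSum _ fun k _ =>
        ((((hF a).pd k).pd j).pd i).continuous.pow 2

lemma H3sq_nonneg {ι : Type*} [Fintype ι] (F : Spc 3 → ι → ℝ) : 0 ≤ H3sq F := by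
  have h2 : 0 ≤ D2L2sq F := integral_nonneg fun x => by
    simp only [ptsqD2, Pi.zero_apply]
    positivity
  have h3 : 0 ≤ D3L2sq F := integral_nonneg fun x => by
    simp only [ptsqD3, Pi.zero_apply]
    positivity
  have h0 := L2sq_nonneg F
  have h1 := D1L2sq_nonneg F
  unfold H3sq
  linarith

lemma le_iSup_mem_Icc {f : ℝ → ℝ} (hf : Continuous f) (h0 : ∀ s, 0 ≤ f s) {T t : ℝ}
    (ht : t ∈ Set.Icc 0 T) : f t ≤ ⨆ s ∈ Set.Icc 0 T, f s := by
  obtain ⟨b, hb⟩ := (isCompact_Icc (a := (0 : ℝ)) (b := T)).bddAbove_image hf.continuousOn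
  have hbdd : BddAbove (Set.range fun s => ⨆ _ : s ∈ Set.Icc 0 T, f s) := by
    refine ⟨b, ?_⟩
    rintro _ ⟨s, rfl⟩
    by_cases hs : s ∈ Set.Icc 0 T
    · simp only [ciSup_pos hs]
      exact hb ⟨s, hs, rfl⟩
    · have : IsEmpty (s ∈ Set.Icc 0 T) := ⟨hs⟩
      simp only [Real.iSup_of_isEmpty]
      exact (h0 t).trans (hb ⟨t, ht, rfl⟩)
  exact le_ciSup_of_le hbdd t (by rw [ciSup_pos ht])

variable {I : Set ℝ} {p : ℝ → Spc 3 → ℝ} {u : ℝ → Spc 3 → Vec 3}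

lemma IsNS.smoothS_u (h : IsNS 3 I p u) (a : Fin 3) : SmoothS fun t x => u t x a :=
  contDiff_pi.1 h.smooth_u a

lemma IsNS.smoothPerV (h : IsNS 3 I p u) (t : ℝ) : SmoothPerV (u t) := fun a =>
  ⟨(h.smoothS_u a).slice t, fun x k => congrFun (h.per_u t x k) a⟩

lemma IsNS.smoothS_stress (h : IsNS 3 I p u) (ij : Fin 3 × Fin 3) :
    SmoothS fun t x => mtx (stress u t) x ij :=
  ContDiff.sub (ContDiff.mul (h.smoothS_u ij.1) (h.smoothS_u ij.2)) ((h.smoothS_u ij.1).pd ij.2)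

lemma IsNS.smoothPer_stress (h : IsNS 3 I p u) (t : ℝ) (ij : Fin 3 × Fin 3) :
    SmoothPer fun x => mtx (stress u t) x ij :=
  ((h.smoothPerV t ij.1).mul (h.smoothPerV t ij.2)).sub ((h.smoothPerV t ij.1).pd ij.2)

lemma IsNS.H3sq_stress_le {T0 : ℝ} (h : IsNS 3 (Set.Icc 0 T0) p u) {t : ℝ}
    (ht : t ∈ Set.Icc 0 T0) : 1 + H3sq (mtx (stress u t)) ≤ Kc T0 p u := by
  have hc : Continuous fun t =>
      H3sq (sc (p t)) + H3sq (u t) + H3sq (mtx (stress u t)) :=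
    ((continuous_H3sq (F := fun t => sc (p t)) fun _ => h.smooth_p).add
      (continuous_H3sq h.smoothS_u)).add
      (continuous_H3sq (F := fun t => mtx (stress u t)) h.smoothS_stress)
  have := le_iSup_mem_Icc hc (fun s => add_nonneg (add_nonneg (H3sq_nonneg _) (H3sq_nonneg _))
    (H3sq_nonneg _)) ht
  unfold Kc
  linarith [H3sq_nonneg (sc (p t)), H3sq_nonneg (u t)]

/-- At a maximum of `|u|` the gradient part of the stress is invisible, so that the stress
controls `|u|²`. -/
lemma ptsq_sq_le_of_stress_le {t : ℝ} (hu : SmoothPerV (u t)) {H : ℝ} (hH0 : 0 ≤ H)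
    (hH : ∀ x, ptsq (mtx (stress u t)) x ≤ H) (x : Spc 3) : ptsq (u t) x ^ 2 ≤ H := by
  have hg : SmoothPer (ptsq (u t)) := SmoothPer.sum _ fun a _ => (hu a).pow 2
  obtain ⟨x₀, hx₀⟩ := exists_forall_le_of_per hg.continuous hg.per
  refine (pow_le_pow_left₀ (ptsq_nonneg _ x) (hx₀ x) 2).trans ?_
  have hmax : fderiv ℝ (ptsq (u t)) x₀ = 0 :=
    IsLocalMax.fderiv_eq_zero (Filter.Eventually.of_forall hx₀)
  have hgrad : ∀ j, ∑ i, u t x₀ i * pd j (fun y => u t y i) x₀ = 0 := by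
    intro j
    have h1 : pd j (ptsq (u t)) x₀ = 0 := by
      unfold pd
      rw [hmax]
      rfl
    have e : ptsq (u t) = fun y => u t y 0 * u t y 0 + u t y 1 * u t y 1 + u t y 2 * u t y 2 := by
      funext y
      simp only [ptsq, Fin.sum_univ_three, sq]
    have m := fun b => (hu b).mul (hu b)
    rw [e, pd_add ((m 0).add (m 1)) (m 2), pd_add (m 0) (m 1), pd_mul (hu 0) (hu 0),
      pd_mul (hu 1) (hu 1), pd_mul (hu 2) (hu 2)] at h1
    rw [Fin.sum_univ_three]
    linarith
  have e1 : ptsq (u t) x₀ ^ 2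
      = ∑ ij : Fin 3 × Fin 3, (u t x₀ ij.1 * u t x₀ ij.2) * mtx (stress u t) x₀ ij := by
    have g0 := hgrad 0
    have g1 := hgrad 1
    have g2 := hgrad 2
    simp only [Fintype.sum_prod_type, Fin.sum_univ_three, ptsq, mtx, stress] at g0 g1 g2 ⊢
    linear_combination u t x₀ 0 * g0 + u t x₀ 1 * g1 + u t x₀ 2 * g2
  have e2 : ∑ ij : Fin 3 × Fin 3, (u t x₀ ij.1 * u t x₀ ij.2) ^ 2 = ptsq (u t) x₀ ^ 2 := by
    simp only [Fintype.sum_prod_type, Fin.sum_univ_three, ptsq]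
    ring
  have cs := Finset.sum_mul_sq_le_sq_mul_sq Finset.univ
    (fun ij : Fin 3 × Fin 3 => u t x₀ ij.1 * u t x₀ ij.2) fun ij => mtx (stress u t) x₀ ij
  rw [← e1, e2] at cs
  have hx := hH x₀
  unfold ptsq at hx
  rcases (sq_nonneg (ptsq (u t) x₀)).eq_or_lt with h0 | h0
  · rw [← h0]
    exact hH0
  · have h1 : (ptsq (u t) x₀ ^ 2) ^ 2 ≤ ptsq (u t) x₀ ^ 2 * H :=
      cs.trans (mul_le_mul_of_nonneg_left hx h0.le)
    rw [sq (ptsq (u t) x₀ ^ 2)] at h1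
    exact le_of_mul_le_mul_left h1 h0

lemma ptsq_curl3_le_of_stress_le {t : ℝ} (hu : SmoothPerV (u t)) {H : ℝ} (hH0 : 0 ≤ H)
    (hH : ∀ x, ptsq (mtx (stress u t)) x ≤ H) (x : Spc 3) :
    ptsq (curl3 (u t)) x ≤ 8 * H := by
  have h1 : ptsqD1 (u t) x ≤ ∑ i, ∑ j, (2 * stress u t x i j ^ 2
      + 2 * (u t x i * u t x j) ^ 2) := by
    refine Finset.sum_le_sum fun i _ => Finset.sum_le_sum fun j _ => ?_
    have e : pd j (fun y => u t y i) x = u t x i * u t x j - stress u t x i j := by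
      simp [stress]
    rw [e]
    nlinarith [sq_nonneg (u t x i * u t x j + stress u t x i j)]
  have h2 : ∑ i, ∑ j, (2 * stress u t x i j ^ 2 + 2 * (u t x i * u t x j) ^ 2)
      = 2 * ptsq (mtx (stress u t)) x + 2 * ptsq (u t) x ^ 2 := by
    simp only [ptsq, mtx, Fintype.sum_prod_type, Fin.sum_univ_three]
    ring
  have h3 := sum_sq_curl3_le (u t) x
  have h4 := ptsq_sq_le_of_stress_le hu hH0 hH x
  have h5 := hH x
  have e : ptsq (curl3 (u t)) x = ∑ a, curl3 (u t) x a ^ 2 := rfl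
  linarith

end SolutionBounds

section RelaxationBounds

lemma IsRelax.smoothPerV {ε δ : ℝ} {Tl : ℝ≥0∞} {p : ℝ → Spc 3 → ℝ} {u : ℝ → Spc 3 → Vec 3}
    {U : ℝ → Spc 3 → Fin 3 → Fin 3 → ℝ} (h : IsRelax 3 ε δ Tl p u U) {t : ℝ} (ht : t ∈ Itv Tl) :
    SmoothPerV (u t) := by
  intro a
  refine ⟨?_, fun x k => congrFun (h.per_u t ht x k) a⟩
  have hu : ContDiff ℝ (⊤ : ℕ∞) (u t) := by
    rcases ht.1.eq_or_lt with h0 | h0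
    · subst h0
      exact contDiff_fst.comp (contDiff_snd.comp h.init_smooth)
    · refine contDiff_iff_contDiffAt.2 fun x => ?_
      have h1 := (h.smooth t ht h0 x).comp x (f := fun y : Spc 3 => (t, y))
        (contDiff_prodMk_right t).contDiffAt
      exact h1.snd.fst
  exact contDiff_pi.1 hu a

lemma ptsq_le_LinfN_sq {v : Spc 3 → Vec 3} (hv : SmoothPerV v) (x : Spc 3) :
    ptsq v x ≤ LinfN v ^ 2 := by
  have hg : SmoothPer (ptsq v) := SmoothPer.sum _ fun a _ => (hv a).pow 2
  obtain ⟨x₀, hx₀⟩ := exists_forall_le_of_per hg.continuous hg.per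
  have hbdd : BddAbove (Set.range fun y => √(ptsq v y)) := by
    refine ⟨√(ptsq v x₀), ?_⟩
    rintro _ ⟨y, rfl⟩
    exact Real.sqrt_le_sqrt (hx₀ y)
  have h1 : √(ptsq v x) ≤ LinfN v := le_ciSup hbdd x
  calc ptsq v x = √(ptsq v x) ^ 2 := (Real.sq_sqrt (ptsq_nonneg v x)).symm
    _ ≤ _ := pow_le_pow_left₀ (Real.sqrt_nonneg _) h1 2

end RelaxationBounds

/-- estimate (4.12) of the paper: bound for the term
`T_II = −∫ (ω^{ε,δ} − ω) · (A^{ε,δ} − A) dx` in the modulated energy evolution,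
under the bootstrap assumptions. -/
theorem modulated_energy_TII_bound :
    ∃ C > (0:ℝ),
      ∀ (T0 : ℝ) (p : ℝ → Spc 3 → ℝ) (u : ℝ → Spc 3 → Vec 3),
        0 < T0 → IsNS 3 (Set.Icc 0 T0) p u →
      ∀ (pe : ℝ → ℝ → ℝ → Spc 3 → ℝ) (ue : ℝ → ℝ → ℝ → Spc 3 → Vec 3)
        (Ue : ℝ → ℝ → ℝ → Spc 3 → Fin 3 → Fin 3 → ℝ) (Tl : ℝ → ℝ → ℝ≥0∞),
        (∀ ε δ : ℝ, 0 < ε → 0 < δ →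
          IsMaxRelax 3 ε δ (Tl ε δ) (pe ε δ) (ue ε δ) (Ue ε δ)) →
      ∀ M μ : ℝ, 0 < M → 0 < μ →
      ∃ η > (0:ℝ), ∀ ε δ : ℝ, 0 < ε → 0 < δ → δ < η →
      ∀ t ∈ Set.Icc (0:ℝ) T0, ENNReal.ofReal t < Tl ε δ →
        -- bootstrap assumptions at time `t`
        LinfN (ue ε δ t) ^ 2
            + LpN 3 (mtx fun x i j => pd j (fun y => ue ε δ t y i) x) ^ 2 ≤ M →
        δ ^ (-(1:ℝ)/2) * L2sq (sc fun x => divv (ue ε δ t) x)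
            + δ ^ ((1:ℝ)/2) * D1L2sq (sc fun x => divv (ue ε δ t) x) ≤ μ →
        L2sq (fun x (b : Fin 3) => ue ε δ t x b - u t x b) ≤ μ * δ ^ ((1:ℝ)/2) →
        -- conclusion: the bound on `|T_II|`
        |-∫ x in cube 3, ∑ a,
            (curl3 (ue ε δ t) x a - curl3 (u t) x a) *
              (Af (ue ε δ t) x a - Af (u t) x a)| ≤
          (7/10) * D1L2sq
              (fun x (b : Fin 3) => curl3 (ue ε δ t) x b - curl3 (u t) x b)
            + C * (Kc T0 p u + M) * μ * δ ^ ((1:ℝ)/2) := by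
  refine ⟨4000, by norm_num, ?_⟩
  intro T0 p u _ hNS pe ue Ue Tl hRel M μ hM hμ
  set B : ℝ := √(8 * Kc T0 p u) with hBdef
  set η : ℝ := ((1 / 400) ^ 3 / ((2 * M + 2 * B) ^ 2 * μ)) ^ 2 with hηdef
  have hB0 : 0 ≤ B := Real.sqrt_nonneg _
  refine ⟨η, by positivity, ?_⟩
  intro ε δ hε hδ hδη t ht htl hyp1 hyp2 hyp3
  have hK : 1 + H3sq (mtx (stress u t)) ≤ Kc T0 p u := hNS.H3sq_stress_le ht
  have hK1 : 1 ≤ Kc T0 p u := by linarith [H3sq_nonneg (mtx (stress u t))]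
  have hB : 0 < B := Real.sqrt_pos.2 (by linarith)
  have hB2 : B ^ 2 = 8 * Kc T0 p u := Real.sq_sqrt (by linarith)
  have hv : SmoothPerV (ue ε δ t) := (hRel ε δ hε hδ).1.smoothPerV ⟨ht.1, htl⟩
  have hu : SmoothPerV (u t) := hNS.smoothPerV t
  have hH : ∀ x, ptsq (mtx (stress u t)) x ≤ B ^ 2 := fun x => by
    have := ptsq_le_H3sq (hNS.smoothPer_stress t) x
    linarith
  have huB : ∀ x, ptsq (u t) x ≤ B := fun x =>
    (pow_le_pow_iff_left₀ (ptsq_nonneg _ x) hB0 two_ne_zero).1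
      (ptsq_sq_le_of_stress_le hu (sq_nonneg B) hH x)
  have hvM : ∀ x, ptsq (ue ε δ t) x ≤ M := fun x => by
    linarith [ptsq_le_LinfN_sq hv x,
      sq_nonneg (LpN 3 (mtx fun x i j => pd j (fun y => ue ε δ t y i) x))]
  have hs : 0 < δ ^ ((1 : ℝ) / 2) := by positivity
  have hdv : L2sq (sc fun x => divv (ue ε δ t) x) ≤ μ * δ ^ ((1 : ℝ) / 2) := by
    have h1 : δ ^ (-(1 : ℝ) / 2) * L2sq (sc fun x => divv (ue ε δ t) x) ≤ μ := by
      have := mul_nonneg hs.le (D1L2sq_nonneg (sc fun x => divv (ue ε δ t) x))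
      linarith
    rw [neg_div, Real.rpow_neg hδ.le, inv_mul_le_iff₀ hs] at h1
    linarith
  have hsmall : (2 * M + 2 * B) ^ 2 * (μ * δ ^ ((1 : ℝ) / 2)) ≤ (1 / 400) ^ 3 := by
    have h1 : δ ^ ((1 : ℝ) / 2) ≤ (1 / 400) ^ 3 / ((2 * M + 2 * B) ^ 2 * μ) := by
      rw [← Real.sqrt_eq_rpow]
      exact Real.sqrt_le_iff.2 ⟨by positivity, hδη.le⟩
    rw [le_div_iff₀ (by positivity)] at h1
    linarith
  have hm : 0 ≤ μ * δ ^ ((1 : ℝ) / 2) := by positivity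
  refine (abs_integral_curl_mul_Af_sub_le hv hu (hNS.div_free t ht) hM.le hB hm hvM huB
    (ptsq_curl3_le_of_stress_le hu (sq_nonneg B) hH) hdv hyp3 hsmall).trans ?_
  have h1 : 8 * M + 384 * B ^ 2 + 1 ≤ 4000 * (Kc T0 p u + M) := by
    rw [hB2]
    linarith
  have h2 := mul_le_mul_of_nonneg_right h1 hm
  linarith

end NSRelax
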